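/- arXiv:2503.14441 — 2 statements merged into one kernel-verified Lean document; each statement's English description precedes it below -/
import Mathlib

section
/- The restriction map O(E8(-2)) → O(A_{E8(-2)}), sending an isometry to the induced isometry of the discriminant quadratic group, is surjective. -/
/-- A Gram matrix of the `E8` root lattice (the Cartan matrix of `E8`):
even, unimodular, positive definite of rank `8`. -/
def gramE8 : Matrix (Fin 8) (Fin 8) ℤ :=
  !![ 2,-1, 0, 0, 0, 0, 0, 0;
     -1, 2,-1, 0, 0, 0, 0, 0;
      0,-1, 2,-1, 0, 0, 0,-1;
      0, 0,-1, 2,-1, 0, 0, 0;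
      0, 0, 0,-1, 2,-1, 0, 0;
      0, 0, 0, 0,-1, 2,-1, 0;
      0, 0, 0, 0, 0,-1, 2, 0;
      0, 0,-1, 0, 0, 0, 0, 2]

/-- The bilinear form of `E8(-2)` (the `E8` form scaled by `-2`), extended to `ℚ^8`. -/
noncomputable def bE8neg2Q : LinearMap.BilinForm ℚ (Fin 8 → ℚ) :=
  Matrix.toBilin' (((-2 : ℚ)) • gramE8.map (Int.cast : ℤ → ℚ))

/-- The inclusion `ℤ^8 → ℚ^8` of the lattice `E8(-2)` into `E8(-2) ⊗ ℚ`. -/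
def c8 : (Fin 8 → ℤ) →ₗ[ℤ] (Fin 8 → ℚ) where
  toFun x := fun i => (x i : ℚ)
  map_add' x y := by funext i; simp
  map_smul' z x := by funext i; simp

/-- The dual lattice `E8(-2)* = {x ∈ ℚ^8 : (x, E8(-2)) ⊆ ℤ}` of `E8(-2)`,
as a `ℤ`-submodule of `ℚ^8`. -/
noncomputable def dualE8neg2 : Submodule ℤ (Fin 8 → ℚ) where
  carrier := {x | ∀ e : Fin 8 → ℤ, ∃ n : ℤ, bE8neg2Q x (c8 e) = n}
  zero_mem' := fun e => ⟨0, by simp⟩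
  add_mem' := by
    intro x y hx hy e
    obtain ⟨n, hn⟩ := hx e
    obtain ⟨m, hm⟩ := hy e
    exact ⟨n + m, by rw [map_add, LinearMap.add_apply, hn, hm]; push_cast; ring⟩
  smul_mem' := by
    intro z x hx e
    obtain ⟨n, hn⟩ := hx e
    exact ⟨z * n, by rw [map_zsmul, LinearMap.smul_apply, hn, zsmul_eq_mul]; push_cast; ring⟩

/-- The discriminant group `A_{E8(-2)} = E8(-2)*/E8(-2)`. -/
noncomputable def discE8neg2 : Type :=
  dualE8neg2 ⧸ ((LinearMap.range c8).comap dualE8neg2.subtype)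

noncomputable instance : AddCommGroup discE8neg2 :=
  inferInstanceAs (AddCommGroup (dualE8neg2 ⧸ ((LinearMap.range c8).comap dualE8neg2.subtype)))

noncomputable instance : Module ℤ discE8neg2 :=
  inferInstanceAs (Module ℤ (dualE8neg2 ⧸ ((LinearMap.range c8).comap dualE8neg2.subtype)))

/-- The bilinear form of `E8(-2)` on `ℤ^8`. -/
noncomputable def bE8neg2 : LinearMap.BilinForm ℤ (Fin 8 → ℤ) :=
  Matrix.toBilin' ((-2 : ℤ) • gramE8)

open scoped Matrix

/-- The quadratic form `(x, x) / 2` of the `E8` lattice in the basis of simple roots. -/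
def quadE8 (x : Fin 8 → ℤ) : ℤ :=
  x 0 * x 0 + x 1 * x 1 + x 2 * x 2 + x 3 * x 3 + x 4 * x 4 + x 5 * x 5 + x 6 * x 6 + x 7 * x 7
    - x 0 * x 1 - x 1 * x 2 - x 2 * x 3 - x 3 * x 4 - x 4 * x 5 - x 5 * x 6 - x 2 * x 7

/-- The bilinear form of the `E8` lattice in the basis of simple roots. -/
noncomputable def bilE8 : LinearMap.BilinForm ℤ (Fin 8 → ℤ) :=
  Matrix.toBilin' gramE8

theorem bilE8_eq (x y : Fin 8 → ℤ) : bilE8 x y = quadE8 (x + y) - quadE8 x - quadE8 y := by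
  simp [bilE8, Matrix.toBilin'_apply, Fin.sum_univ_eight, gramE8, quadE8]
  ring

theorem bilE8_self (x : Fin 8 → ℤ) : bilE8 x x = 2 * quadE8 x := by
  rw [bilE8_eq]
  simp [quadE8]
  ring

theorem bilE8_comm (x y : Fin 8 → ℤ) : bilE8 x y = bilE8 y x := by
  rw [bilE8_eq, bilE8_eq, add_comm x y]
  ring

theorem bilE8_single (i j : Fin 8) : bilE8 (Pi.single i 1) (Pi.single j 1) = gramE8 i j :=
  Matrix.toBilin'_single gramE8 i j

theorem quadE8_pos {x : Fin 8 → ℤ} (hx : x ≠ 0) : 0 < quadE8 x := by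
  by_contra! h
  apply hx
  have key : 120 * quadE8 x = 30 * (2 * x 0 - x 1) ^ 2 + 10 * (3 * x 1 - 2 * x 2) ^ 2
      + 30 * (2 * x 7 - x 2) ^ 2 + 30 * (2 * x 6 - x 5) ^ 2 + 10 * (3 * x 5 - 2 * x 4) ^ 2
      + 5 * (4 * x 4 - 3 * x 3) ^ 2 + 3 * (5 * x 3 - 4 * x 2) ^ 2 + 2 * x 2 ^ 2 := by
    simp only [quadE8]
    ring
  have p1 := sq_nonneg (2 * x 0 - x 1)
  have p2 := sq_nonneg (3 * x 1 - 2 * x 2)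
  have p3 := sq_nonneg (2 * x 7 - x 2)
  have p4 := sq_nonneg (2 * x 6 - x 5)
  have p5 := sq_nonneg (3 * x 5 - 2 * x 4)
  have p6 := sq_nonneg (4 * x 4 - 3 * x 3)
  have p7 := sq_nonneg (5 * x 3 - 4 * x 2)
  have p8 := sq_nonneg (x 2)
  have z1 : 2 * x 0 - x 1 = 0 := pow_eq_zero_iff two_ne_zero |>.mp (by linarith)
  have z2 : 3 * x 1 - 2 * x 2 = 0 := pow_eq_zero_iff two_ne_zero |>.mp (by linarith)
  have z3 : 2 * x 7 - x 2 = 0 := pow_eq_zero_iff two_ne_zero |>.mp (by linarith)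
  have z4 : 2 * x 6 - x 5 = 0 := pow_eq_zero_iff two_ne_zero |>.mp (by linarith)
  have z5 : 3 * x 5 - 2 * x 4 = 0 := pow_eq_zero_iff two_ne_zero |>.mp (by linarith)
  have z6 : 4 * x 4 - 3 * x 3 = 0 := pow_eq_zero_iff two_ne_zero |>.mp (by linarith)
  have z7 : 5 * x 3 - 4 * x 2 = 0 := pow_eq_zero_iff two_ne_zero |>.mp (by linarith)
  have z8 : x 2 = 0 := pow_eq_zero_iff two_ne_zero |>.mp (by linarith)
  ext i
  fin_cases i <;> simp <;> omega

/-- Vectors whose doubles move each `0`-`1` vector of norm `2` or `6` to a root. -/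
def rootShifts : List (Fin 8 → ℤ) :=
  [![0, 0, 0, 0, 0, 0, 0, 0], ![1, 1, 1, 1, 1, 1, 1, 1], ![1, 1, 2, 2, 1, 1, 1, 1],
    ![1, 1, 2, 1, 1, 1, 1, 1], ![1, 1, 1, 1, 1, 1, 0, 1], ![1, 2, 3, 2, 2, 1, 1, 2],
    ![0, 1, 1, 1, 1, 1, 1, 1], ![1, 1, 2, 2, 2, 1, 1, 1], ![1, 1, 1, 1, 1, 0, 0, 1],
    ![1, 1, 2, 1, 1, 1, 0, 1], ![1, 2, 2, 2, 1, 1, 1, 1], ![1, 2, 2, 2, 2, 1, 1, 1],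
    ![0, 1, 1, 1, 1, 1, 0, 1], ![1, 1, 2, 2, 1, 1, 0, 1], ![1, 2, 3, 2, 2, 1, 1, 1],
    ![1, 2, 2, 2, 1, 1, 0, 1], ![1, 1, 2, 1, 1, 0, 0, 1], ![0, 1, 1, 1, 1, 0, 0, 1],
    ![1, 2, 3, 3, 2, 1, 1, 2], ![1, 1, 1, 1, 0, 0, 0, 1], ![1, 2, 3, 3, 2, 2, 1, 2],
    ![0, 1, 1, 1, 0, 0, 0, 1]]

theorem exists_rootShift : ∀ b : Fin 8 → Bool,
    quadE8 (fun i => (b i).toInt) % 2 = 1 →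
      ∃ s ∈ rootShifts, quadE8 (fun i => (b i).toInt - 2 * s i) = 1 := by
  decide +kernel

/-- Every vector of odd half-norm is congruent to a root modulo `2`. -/
theorem exists_root_congr (v : Fin 8 → ℤ) (hv : quadE8 v % 2 = 1) :
    ∃ r w : Fin 8 → ℤ, quadE8 r = 1 ∧ r = v + (2 : ℤ) • w := by
  have hb : ∀ i, v i = (decide (v i % 2 = 1)).toInt + 2 * (v i / 2) := fun i => by
    rcases Int.emod_two_eq_zero_or_one (v i) with h | h <;> simp [h] <;> omega
  have hq (u w : Fin 8 → ℤ) : quadE8 (u + (2 : ℤ) • w) % 2 = quadE8 u % 2 := by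
    have h : quadE8 (u + (2 : ℤ) • w) = quadE8 u + 2 * (bilE8 u w + 2 * quadE8 w) := by
      rw [bilE8_eq]
      simp [quadE8]
      ring
    omega
  set b : Fin 8 → Bool := fun i => decide (v i % 2 = 1)
  have hvb : v = (fun i => (b i).toInt) + (2 : ℤ) • fun i => v i / 2 := funext hb
  rw [hvb, hq] at hv
  obtain ⟨s, -, hs⟩ := exists_rootShift b hv
  refine ⟨_, fun i => -(v i / 2) - s i, hs, funext fun i => ?_⟩
  have := hb i
  simp only [Pi.add_apply, Pi.smul_apply, smul_eq_mul]
  simp only [b]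
  linarith

theorem bilE8_abs_le_one {r s : Fin 8 → ℤ} (hr : quadE8 r = 1) (hs : quadE8 s = 1)
    (hadd : r + s ≠ 0) (hsub : r - s ≠ 0) : |bilE8 r s| ≤ 1 := by
  have h1 := quadE8_pos hadd
  have h2 := quadE8_pos hsub
  have h3 := bilE8_eq r s
  have h4 : quadE8 (r - s) = quadE8 r + quadE8 s - bilE8 r s := by
    rw [bilE8_eq]
    simp [quadE8]
    ring
  rw [abs_le]
  constructor <;> linarith

theorem gramE8_comm (i j : Fin 8) : gramE8 i j = gramE8 j i := by
  revert j
  fin_cases i <;> decide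

theorem gramE8_of_lt (i j : Fin 8) (hij : i < j) : gramE8 i j = 0 ∨
    (i, j) ∈ ([(0, 1), (1, 2), (2, 3), (3, 4), (4, 5), (5, 6), (2, 7)] : List (Fin 8 × Fin 8)) ∧
      gramE8 i j = -1 := by
  revert j
  fin_cases i <;> decide

/-- A symmetric matrix congruent to `gramE8` mod `2` with entries in `{-1, 0, 1}` off the
diagonal and `2` on it becomes `gramE8` after sign changes of the basis. -/
theorem exists_signs (A : Fin 8 → Fin 8 → ℤ) (hsymm : ∀ i j, A i j = A j i)
    (hdiag : ∀ i, A i i = 2) (habs : ∀ i j, i ≠ j → |A i j| ≤ 1)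
    (hmod : ∀ i j, A i j % 2 = gramE8 i j % 2) :
    ∃ s : Fin 8 → ℤ, (∀ i, s i = 1 ∨ s i = -1) ∧ ∀ i j, s i * s j * A i j = gramE8 i j := by
  have hzero : ∀ i j, i ≠ j → gramE8 i j = 0 → A i j = 0 := fun i j hij h => by
    have h1 := abs_le.mp (habs i j hij)
    have h2 := hmod i j
    omega
  have hedge : ∀ i j, i ≠ j → gramE8 i j = -1 → ∀ a : ℤ, a = 1 ∨ a = -1 →
      ∃ b : ℤ, (b = 1 ∨ b = -1) ∧ a * b * A i j = -1 := fun i j hij h a ha => by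
    have h1 := abs_le.mp (habs i j hij)
    have h2 := hmod i j
    have h3 : A i j = 1 ∨ A i j = -1 := by omega
    refine ⟨-(a * A i j), ?_, ?_⟩ <;> rcases ha with rfl | rfl <;> rcases h3 with h3 | h3 <;>
      simp [h3]
  obtain ⟨s1, p1, e1⟩ := hedge 0 1 (by decide) (by decide) 1 (Or.inl rfl)
  obtain ⟨s2, p2, e2⟩ := hedge 1 2 (by decide) (by decide) s1 p1
  obtain ⟨s3, p3, e3⟩ := hedge 2 3 (by decide) (by decide) s2 p2
  obtain ⟨s4, p4, e4⟩ := hedge 3 4 (by decide) (by decide) s3 p3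
  obtain ⟨s5, p5, e5⟩ := hedge 4 5 (by decide) (by decide) s4 p4
  obtain ⟨s6, p6, e6⟩ := hedge 5 6 (by decide) (by decide) s5 p5
  obtain ⟨s7, p7, e7⟩ := hedge 2 7 (by decide) (by decide) s2 p2
  set s : Fin 8 → ℤ := ![1, s1, s2, s3, s4, s5, s6, s7]
  have hs : ∀ i, s i = 1 ∨ s i = -1 := by
    intro i
    fin_cases i
    exacts [Or.inl rfl, p1, p2, p3, p4, p5, p6, p7]
  have hlt : ∀ i j, i < j → s i * s j * A i j = gramE8 i j := by
    intro i j hij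
    rcases gramE8_of_lt i j hij with h | ⟨h, hG⟩
    · rw [hzero i j hij.ne h, h, mul_zero]
    · rw [hG]
      simp only [List.mem_cons, Prod.mk.injEq, List.not_mem_nil, or_false] at h
      rcases h with ⟨rfl, rfl⟩ | ⟨rfl, rfl⟩ | ⟨rfl, rfl⟩ | ⟨rfl, rfl⟩ | ⟨rfl, rfl⟩ | ⟨rfl, rfl⟩ |
        ⟨rfl, rfl⟩
      exacts [e1, e2, e3, e4, e5, e6, e7]
  refine ⟨s, hs, fun i j => ?_⟩
  rcases lt_trichotomy i j with h | rfl | h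
  · exact hlt i j h
  · have hG : ∀ i, gramE8 i i = 2 := by decide
    rw [hdiag, hG]
    rcases hs i with h | h <;> simp [h]
  · rw [hsymm i j, gramE8_comm i j, mul_comm (s i), hlt j i h]

theorem mem_dual_half (x : Fin 8 → ℤ) : (2⁻¹ : ℚ) • c8 x ∈ dualE8neg2 := by
  intro e
  refine ⟨-bilE8 x e, ?_⟩
  simp [bE8neg2Q, bilE8, Matrix.toBilin'_apply, Fin.sum_univ_eight, gramE8, c8]

/-- The map `x ↦ x / 2` from the lattice to its dual. -/
noncomputable def halfDual : (Fin 8 → ℤ) →ₗ[ℤ] dualE8neg2 :=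
  AddMonoidHom.toIntLinearMap
    { toFun := fun x => ⟨(2⁻¹ : ℚ) • c8 x, mem_dual_half x⟩
      map_zero' := Subtype.ext (by simp)
      map_add' := fun x y => Subtype.ext (by simp) }

/-- The inverse of the Gram matrix `gramE8`. -/
def gramE8Inv : Matrix (Fin 8) (Fin 8) ℤ :=
  !![4, 7, 10, 8, 6, 4, 2, 5;
     7, 14, 20, 16, 12, 8, 4, 10;
     10, 20, 30, 24, 18, 12, 6, 15;
     8, 16, 24, 20, 15, 10, 5, 12;
     6, 12, 18, 15, 12, 8, 4, 9;
     4, 8, 12, 10, 8, 6, 3, 6;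
     2, 4, 6, 5, 4, 3, 2, 3;
     5, 10, 15, 12, 9, 6, 3, 8]

theorem gramE8_mul_gramE8Inv : gramE8 * gramE8Inv = 1 := by
  decide +kernel

theorem halfDual_surjective : Function.Surjective halfDual := by
  rintro ⟨x, hx⟩
  choose n hn using fun i => hx (Pi.single i 1)
  have hG : (gramE8.map (Int.cast : ℤ → ℚ)) * gramE8Inv.map (Int.cast : ℤ → ℚ) = 1 := by
    rw [← Matrix.map_mul_intCast, gramE8_mul_gramE8Inv]
    simp
  have hn' : (-2 : ℚ) • (x ᵥ* gramE8.map (Int.cast : ℤ → ℚ)) = fun i => (n i : ℚ) := by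
    ext i
    rw [← hn i, bE8neg2Q, Matrix.toBilin'_apply']
    have : c8 (Pi.single i 1) = Pi.single i 1 := by
      ext j
      by_cases h : j = i
      · subst h; simp [c8]
      · simp [c8, h]
    rw [this, Matrix.dotProduct_mulVec, Matrix.vecMul_smul, dotProduct_single_one]
  refine ⟨-(n ᵥ* gramE8Inv), Subtype.ext ?_⟩
  have hx' : (-2 : ℚ) • x = c8 (n ᵥ* gramE8Inv) := by
    have : c8 (n ᵥ* gramE8Inv) = (fun i => (n i : ℚ)) ᵥ* gramE8Inv.map (Int.cast : ℤ → ℚ) := by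
      ext i
      simp [c8, Matrix.vecMul, dotProduct]
    rw [this, ← hn', Matrix.smul_vecMul, Matrix.vecMul_vecMul, hG, Matrix.vecMul_one]
  change (2⁻¹ : ℚ) • c8 (-(n ᵥ* gramE8Inv)) = x
  rw [map_neg, ← hx', smul_neg, smul_smul]
  ext i
  simp

/-- The map from the lattice to its discriminant group sending `x` to the class of `x / 2`. -/
noncomputable def halfDisc : (Fin 8 → ℤ) →ₗ[ℤ] discE8neg2 :=
  (Submodule.mkQ ((LinearMap.range c8).comap dualE8neg2.subtype)).comp halfDual

theorem halfDisc_eq_iff (x y : Fin 8 → ℤ) :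
    halfDisc x = halfDisc y ↔ ∃ w : Fin 8 → ℤ, x = y + (2 : ℤ) • w := by
  have key : halfDisc x = halfDisc y ↔ ∃ w, c8 w = (2⁻¹ : ℚ) • c8 x - (2⁻¹ : ℚ) • c8 y :=
    Submodule.Quotient.eq _
  rw [key]
  refine exists_congr fun w => ?_
  simp only [funext_iff, c8, LinearMap.coe_mk, AddHom.coe_mk, Pi.sub_apply, Pi.add_apply,
    Pi.smul_apply, smul_eq_mul]
  refine forall_congr' fun i => ?_
  rw [← Int.cast_inj (α := ℚ)]
  push_cast
  constructor <;> intro h <;> linarith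

theorem halfDisc_surjective : Function.Surjective halfDisc :=
  (Submodule.mkQ_surjective _).comp halfDual_surjective

theorem bE8neg2Q_halfDual (x : Fin 8 → ℤ) :
    bE8neg2Q (halfDual x) (halfDual x) = -quadE8 x := by
  change bE8neg2Q ((2⁻¹ : ℚ) • c8 x) ((2⁻¹ : ℚ) • c8 x) = -quadE8 x
  simp [bE8neg2Q, quadE8, Matrix.toBilin'_apply, Fin.sum_univ_eight, gramE8, c8]
  ring

/-- Vectors whose Gram matrix is `gramE8` define an isometry of the lattice. -/
theorem exists_isometry_of_gram (t : Fin 8 → Fin 8 → ℤ)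
    (ht : ∀ i j, bilE8 (t i) (t j) = gramE8 i j) :
    ∃ f : (Fin 8 → ℤ) ≃ₗ[ℤ] (Fin 8 → ℤ),
      (∀ i, f (Pi.single i 1) = t i) ∧
      (∀ x y, bE8neg2 (f x) (f y) = bE8neg2 x y) ∧
      ∃ F : (Fin 8 → ℚ) ≃ₗ[ℚ] (Fin 8 → ℚ), ∀ e, F (c8 e) = c8 (f e) := by
  set M : Matrix (Fin 8) (Fin 8) ℤ := Matrix.of t
  have hM : M * gramE8 * Mᵀ = gramE8 := by
    ext i j
    rw [← ht i j, bilE8, Matrix.toBilin'_apply', Matrix.dotProduct_mulVec]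
    rfl
  have hr : (gramE8 * Mᵀ * gramE8Inv)ᵀ * Mᵀ = 1 := by
    rw [← Matrix.transpose_mul, ← Matrix.mul_assoc, ← Matrix.mul_assoc, hM, gramE8_mul_gramE8Inv,
      Matrix.transpose_one]
  have hl := mul_eq_one_comm.mp hr
  set N := (gramE8 * Mᵀ * gramE8Inv)ᵀ
  have hlQ : Mᵀ.map (Int.cast : ℤ → ℚ) * N.map (Int.cast : ℤ → ℚ) = 1 := by
    rw [← Matrix.map_mul_intCast, hl]
    simp
  refine ⟨Matrix.toLin'OfInv hr hl, fun i => ?_, fun x y => ?_,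
    Matrix.toLin'OfInv (mul_eq_one_comm.mp hlQ) hlQ, fun e => ?_⟩
  · ext j
    simp [M]
  · change bE8neg2 (Mᵀ *ᵥ x) (Mᵀ *ᵥ y) = bE8neg2 x y
    simp only [bE8neg2, Matrix.toBilin'_apply', Matrix.smul_mulVec, dotProduct_smul]
    rw [Matrix.mulVec_transpose, ← Matrix.dotProduct_mulVec, Matrix.mulVec_mulVec,
      Matrix.mulVec_mulVec, hM]
  · ext i
    simp [c8, Matrix.mulVec, dotProduct]

/-- **Surjectivity of `O(E8(-2)) → O(A_{E8(-2)})`.**  Every automorphism `g` of the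
discriminant group `A_{E8(-2)} = E8(-2)*/E8(-2)` preserving the discriminant quadratic form
(with values in `ℚ/2ℤ`) is induced by an isometry `f` of the lattice `E8(-2)`: the
`ℚ`-linear extension `F` of `f` preserves the dual lattice and the map induced by `F` on
the discriminant group is `g`. -/
theorem OE8neg2_to_disc_surjective :
    ∀ g : discE8neg2 ≃ₗ[ℤ] discE8neg2,
      (∀ x y : dualE8neg2,
        g (Submodule.Quotient.mk x) = Submodule.Quotient.mk y →
        bE8neg2Q x x - bE8neg2Q y y ∈ AddSubgroup.zmultiples (2 : ℚ)) →
      ∃ f : (Fin 8 → ℤ) ≃ₗ[ℤ] (Fin 8 → ℤ),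
        (∀ x y : Fin 8 → ℤ, bE8neg2 (f x) (f y) = bE8neg2 x y) ∧
        ∃ F : (Fin 8 → ℚ) ≃ₗ[ℚ] (Fin 8 → ℚ),
          (∀ e : Fin 8 → ℤ, F (c8 e) = c8 (f e)) ∧
          (∀ x y : dualE8neg2, (y : Fin 8 → ℚ) = F x →
            g (Submodule.Quotient.mk x) = Submodule.Quotient.mk y) := by
  intro g hg
  have hquad : ∀ x y, g (halfDisc x) = halfDisc y → quadE8 x % 2 = quadE8 y % 2 := by
    intro x y h
    obtain ⟨k, hk⟩ := AddSubgroup.mem_zmultiples_iff.mp (hg (halfDual x) (halfDual y) h)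
    rw [bE8neg2Q_halfDual, bE8neg2Q_halfDual, zsmul_eq_mul] at hk
    have : k * 2 = -quadE8 x - -quadE8 y := by exact_mod_cast hk
    omega
  have hroot : ∀ i, ∃ r, quadE8 r = 1 ∧ g (halfDisc (Pi.single i 1)) = halfDisc r := by
    intro i
    obtain ⟨v, hv⟩ := halfDisc_surjective (g (halfDisc (Pi.single i 1)))
    have hi : ∀ i : Fin 8, quadE8 (Pi.single i 1) = 1 := by decide
    have hvq := hquad _ _ hv.symm
    rw [hi] at hvq
    obtain ⟨r, w, hr, hrw⟩ := exists_root_congr v hvq.symm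
    exact ⟨r, hr, hv.symm.trans ((halfDisc_eq_iff r v).mpr ⟨w, hrw⟩).symm⟩
  choose r hr hgr using hroot
  have hdisj : ∀ i j, i ≠ j → halfDisc (r i) ≠ halfDisc (r j) := by
    intro i j hij h
    rw [← hgr, ← hgr, g.injective.eq_iff, halfDisc_eq_iff] at h
    obtain ⟨w, hw⟩ := h
    have := congrFun hw i
    simp [hij] at this
    omega
  obtain ⟨s, hs, hsG⟩ := exists_signs (fun i j => bilE8 (r i) (r j)) (fun i j => bilE8_comm _ _)
    (fun i => by rw [bilE8_self, hr, mul_one])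
    (fun i j hij => bilE8_abs_le_one (hr i) (hr j)
      (fun h => hdisj i j hij ((halfDisc_eq_iff _ _).mpr ⟨-r j, by
        rw [eq_neg_of_add_eq_zero_left h]; module⟩))
      (fun h => hdisj i j hij (congrArg _ (sub_eq_zero.mp h))))
    (fun i j => by
      have h := hquad (Pi.single i 1 + Pi.single j 1) (r i + r j) (by
        rw [map_add, map_add, map_add, hgr, hgr])
      have hi := hquad _ _ (hgr i)
      have hj := hquad _ _ (hgr j)
      rw [← bilE8_single, bilE8_eq, bilE8_eq]
      omega)
  obtain ⟨f, hft, hf, F, hF⟩ := exists_isometry_of_gram (fun i => s i • r i) (fun i j => by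
    rw [← hsG i j]
    simp only [map_smul, LinearMap.smul_apply, smul_eq_mul]
    ring)
  have hgf : halfDisc ∘ₗ f.toLinearMap = g.toLinearMap ∘ₗ halfDisc := by
    refine (Pi.basisFun ℤ (Fin 8)).ext fun i => ?_
    simp only [LinearMap.comp_apply, LinearEquiv.coe_coe, Pi.basisFun_apply, hft, hgr]
    rcases hs i with h | h <;> rw [h]
    · rw [one_smul]
    · exact (halfDisc_eq_iff _ _).mpr ⟨-r i, by module⟩
  refine ⟨f, hf, F, hF, fun x y hxy => ?_⟩
  obtain ⟨x, rfl⟩ := halfDual_surjective x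
  have hy : y = halfDual (f x) := Subtype.ext (by
    rw [hxy]
    change F ((2⁻¹ : ℚ) • c8 x) = (2⁻¹ : ℚ) • c8 (f x)
    rw [map_smul, hF])
  rw [hy]
  exact (LinearMap.congr_fun hgf x).symm
end

section
/- Let T = Λ^σ ≅ U³ ⊕ E8(-2) ⊕ ⟨-2⟩ be the invariant lattice of the swap involution σ inside Λ = U³ ⊕ E8(-1)² ⊕ ⟨-2⟩. Then every isometry φ ∈ O(T) preserves the A_{E8(-2)} component of A_T ≅ A_{E8(-2)} ⊕ A_{⟨-2⟩}; equivalently, φ̄ fixes the generator of the A_{⟨-2⟩} summand. -/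
/-- The Gram matrix of `U³`, three copies of the hyperbolic plane. -/
def gramU3 : Matrix (Fin 6) (Fin 6) ℤ :=
  !![0,1,0,0,0,0; 1,0,0,0,0,0;
     0,0,0,1,0,0; 0,0,1,0,0,0;
     0,0,0,0,0,1; 0,0,0,0,1,0]

/-- The bilinear form of the `E8` lattice on `ℤ^8`. -/
noncomputable def bE8 : LinearMap.BilinForm ℤ (Fin 8 → ℤ) := Matrix.toBilin' gramE8

/-- The bilinear form of `U³` on `ℤ^6`. -/
noncomputable def bU3 : LinearMap.BilinForm ℤ (Fin 6 → ℤ) := Matrix.toBilin' gramU3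

/-- The underlying group of the lattice `Λ = U³ ⊕ E8(-1) ⊕ E8(-1) ⊕ ⟨-2⟩`
(the `K3^[2]` lattice). -/
abbrev LamK3 : Type := (Fin 6 → ℤ) × (Fin 8 → ℤ) × (Fin 8 → ℤ) × ℤ

noncomputable def bLamK3 : LinearMap.BilinForm ℤ LamK3 :=
  bU3.compl₁₂ (LinearMap.fst ℤ _ _) (LinearMap.fst ℤ _ _)
  - bE8.compl₁₂ ((LinearMap.fst ℤ _ _).comp (LinearMap.snd ℤ _ _))
      ((LinearMap.fst ℤ _ _).comp (LinearMap.snd ℤ _ _))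
  - bE8.compl₁₂
      ((LinearMap.fst ℤ _ _).comp ((LinearMap.snd ℤ _ _).comp (LinearMap.snd ℤ _ _)))
      ((LinearMap.fst ℤ _ _).comp ((LinearMap.snd ℤ _ _).comp (LinearMap.snd ℤ _ _)))
  - (2 : ℤ) • ((LinearMap.mul ℤ ℤ).compl₁₂
      ((LinearMap.snd ℤ _ _).comp ((LinearMap.snd ℤ _ _).comp (LinearMap.snd ℤ _ _)))
      ((LinearMap.snd ℤ _ _).comp ((LinearMap.snd ℤ _ _).comp (LinearMap.snd ℤ _ _))))

/-- The involution `σ` of `Λ` swapping the two `E8(-1)` summands. -/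
def sigmaK3 : LamK3 ≃ₗ[ℤ] LamK3 where
  toFun p := (p.1, p.2.2.1, p.2.1, p.2.2.2)
  invFun p := (p.1, p.2.2.1, p.2.1, p.2.2.2)
  map_add' _ _ := rfl
  map_smul' _ _ := rfl
  left_inv _ := rfl
  right_inv _ := rfl

/-- The invariant sublattice `Λ^σ = {v : σ v = v}`. -/
def FixK3 : Submodule ℤ LamK3 :=
  LinearMap.ker (sigmaK3.toLinearMap - LinearMap.id)

/-- The underlying group of the lattice `T = U³ ⊕ E8(-2) ⊕ ⟨-2⟩`. -/
abbrev TK3 : Type := (Fin 6 → ℤ) × (Fin 8 → ℤ) × ℤ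

/-- The bilinear form of `T = U³ ⊕ E8(-2) ⊕ ⟨-2⟩`. -/
noncomputable def bTK3 : LinearMap.BilinForm ℤ TK3 :=
  bU3.compl₁₂ (LinearMap.fst ℤ _ _) (LinearMap.fst ℤ _ _)
  - (2 : ℤ) • (bE8.compl₁₂ ((LinearMap.fst ℤ _ _).comp (LinearMap.snd ℤ _ _))
      ((LinearMap.fst ℤ _ _).comp (LinearMap.snd ℤ _ _)))
  - (2 : ℤ) • ((LinearMap.mul ℤ ℤ).compl₁₂
      ((LinearMap.snd ℤ _ _).comp (LinearMap.snd ℤ _ _))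
      ((LinearMap.snd ℤ _ _).comp (LinearMap.snd ℤ _ _)))

/-- The diagonal embedding `U³ ⊕ E8(-2) ⊕ ⟨-2⟩ → Λ`, `u ⊕ e ⊕ kδ ↦ u ⊕ e ⊕ e ⊕ kδ`. -/
def embDiag : TK3 →ₗ[ℤ] LamK3 where
  toFun p := (p.1, p.2.1, p.2.1, p.2.2)
  map_add' _ _ := rfl
  map_smul' _ _ := rfl

/-- The ambient rational vector space `T ⊗ ℚ` for `T = U³ ⊕ E8(-2) ⊕ ⟨-2⟩`. -/
abbrev VTK3 : Type := (Fin 6 → ℚ) × (Fin 8 → ℚ) × ℚ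

/-- The inclusion `T → T ⊗ ℚ`. -/
def iotaT : TK3 →ₗ[ℤ] VTK3 where
  toFun p := (fun i => (p.1 i : ℚ), fun i => (p.2.1 i : ℚ), (p.2.2 : ℚ))
  map_add' x y := by
    refine Prod.ext (funext fun i => ?_) (Prod.ext (funext fun i => ?_) ?_) <;> simp
  map_smul' c x := by
    refine Prod.ext (funext fun i => ?_) (Prod.ext (funext fun i => ?_) ?_) <;> simp

/-- A representative in `T ⊗ ℚ` of the generator of the `A_{⟨-2⟩}` summand of the
discriminant group `A_T ≅ A_{E8(-2)} ⊕ A_{⟨-2⟩}`: the dual vector `δ/2 = (0, 0, 1/2)`. -/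
noncomputable def wT : VTK3 := (0, 0, (2⁻¹ : ℚ))

/-- The form of `T` in coordinates. -/
theorem bTK3_apply (s t : TK3) : bTK3 s t =
    (s.1 0 * t.1 1 + s.1 1 * t.1 0 + s.1 2 * t.1 3 + s.1 3 * t.1 2
      + s.1 4 * t.1 5 + s.1 5 * t.1 4)
    - 2 * (∑ i, s.2.1 i * (gramE8.mulVec t.2.1) i) - 2 * (s.2.2 * t.2.2) := by
  have hU : bU3 s.1 t.1 = s.1 0 * t.1 1 + s.1 1 * t.1 0 + s.1 2 * t.1 3 + s.1 3 * t.1 2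
      + s.1 4 * t.1 5 + s.1 5 * t.1 4 := by
    simp [bU3, gramU3, Matrix.toBilin'_apply', dotProduct, Matrix.mulVec, Fin.sum_univ_succ]
    ring
  have hE : bE8 s.2.1 t.2.1 = ∑ i, s.2.1 i * (gramE8.mulVec t.2.1) i := by
    rw [bE8, Matrix.toBilin'_apply', dotProduct]
  simp [bTK3, hU, hE]

/-- The `E8` lattice is even. -/
theorem even_sum_mul_gramE8_mulVec (e : Fin 8 → ℤ) :
    Even (∑ i, e i * (gramE8.mulVec e) i) := by
  refine ⟨e 0 ^ 2 + e 1 ^ 2 + e 2 ^ 2 + e 3 ^ 2 + e 4 ^ 2 + e 5 ^ 2 + e 6 ^ 2 + e 7 ^ 2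
    - e 0 * e 1 - e 1 * e 2 - e 2 * e 3 - e 3 * e 4 - e 4 * e 5 - e 5 * e 6 - e 2 * e 7, ?_⟩
  simp [gramE8, Matrix.mulVec, dotProduct, Fin.sum_univ_eight]
  ring

/-- The Gram matrix of `E8` is injective modulo `2`. -/
theorem two_dvd_of_two_dvd_gramE8_mulVec {e : Fin 8 → ℤ}
    (h : ∀ i, 2 ∣ (gramE8.mulVec e) i) (i : Fin 8) : 2 ∣ e i := by
  have h0 := h 0
  have h1 := h 1
  have h2 := h 2
  have h3 := h 3
  have h4 := h 4
  have h5 := h 5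
  have h6 := h 6
  have h7 := h 7
  simp [gramE8, Matrix.mulVec, dotProduct, Fin.sum_univ_eight] at h0 h1 h2 h3 h4 h5 h6 h7
  fin_cases i <;> simp only [Fin.zero_eta, Fin.mk_one, Fin.reduceFinMk] <;> omega

/-- A vector pairing evenly with all of `T` has even `U³` component. -/
theorem two_dvd_fst_of_two_dvd_bTK3 {t : TK3} (h : ∀ s, 2 ∣ bTK3 t s) (i : Fin 6) :
    2 ∣ t.1 i := by
  have h' (j : Fin 6) := h (Pi.single j 1, 0, 0)
  simp only [bTK3_apply] at h'
  have h0 := h' 0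
  have h1 := h' 1
  have h2 := h' 2
  have h3 := h' 3
  have h4 := h' 4
  have h5 := h' 5
  simp at h0 h1 h2 h3 h4 h5
  fin_cases i <;> assumption

/-- `δ/2` represents the characteristic element of the discriminant bilinear form:
on vectors `t ∈ 2 T^∨`, the form satisfies `b t t ≡ b t δ` modulo `4`. -/
theorem four_dvd_bTK3_self_sub {t : TK3} (h : ∀ s, 2 ∣ bTK3 t s) :
    4 ∣ bTK3 t t - bTK3 t (0, 0, 1) := by
  choose a ha using two_dvd_fst_of_two_dvd_bTK3 h
  obtain ⟨n, hn⟩ := even_sum_mul_gramE8_mulVec t.2.1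
  obtain ⟨m, hm⟩ := Int.even_mul_pred_self t.2.2
  rw [bTK3_apply, bTK3_apply, hn]
  simp only [ha]
  refine ⟨2 * (a 0 * a 1 + a 2 * a 3 + a 4 * a 5) - n - m, ?_⟩
  simp
  linear_combination (-2) * hm

/-- An isometry of `T` fixes `δ` modulo `2 T`. -/
theorem exists_isometry_apply_eq_add_two_smul (φ : TK3 ≃ₗ[ℤ] TK3)
    (hφ : ∀ s t : TK3, bTK3 (φ s) (φ t) = bTK3 s t) :
    ∃ v : TK3, φ (0, 0, 1) = (0, 0, 1) + (2 : ℤ) • v := by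
  have hδ : ∀ s, 2 ∣ bTK3 (φ (0, 0, 1)) s := fun s => by
    rw [← φ.apply_symm_apply s, hφ, bTK3_apply]
    simp
  have key : ∀ s, (∀ t, 2 ∣ bTK3 s t) →
      4 ∣ bTK3 s (φ (0, 0, 1)) - bTK3 s (0, 0, 1) := fun s hs => by
    have hs' : ∀ t, 2 ∣ bTK3 (φ.symm s) t := fun t => by
      rw [← hφ, φ.apply_symm_apply]
      exact hs _
    have h₁ := four_dvd_bTK3_self_sub hs'
    rw [← hφ, ← hφ (φ.symm s) (0, 0, 1), φ.apply_symm_apply] at h₁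
    have h₂ := four_dvd_bTK3_self_sub hs
    omega
  generalize φ (0, 0, 1) = y at hδ key ⊢
  obtain ⟨u, e, k⟩ := y
  choose a ha using two_dvd_fst_of_two_dvd_bTK3 hδ
  have he : ∀ i, 2 ∣ (gramE8.mulVec e) i := fun i => by
    have h := key (0, Pi.single i 1, 0) fun t => by
      rw [bTK3_apply]
      simp
    rw [bTK3_apply, bTK3_apply] at h
    simp [Pi.single_apply] at h
    omega
  choose f hf using two_dvd_of_two_dvd_gramE8_mulVec he
  have hk := key (0, 0, 1) fun t => by
    rw [bTK3_apply]
    simp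
  rw [bTK3_apply, bTK3_apply] at hk
  simp at hk
  obtain ⟨m, hm⟩ : 2 ∣ k - 1 := by omega
  refine ⟨(a, f, m), Prod.ext (funext fun i => ?_) (Prod.ext (funext fun i => ?_) ?_)⟩
  · simpa using ha i
  · simpa using hf i
  · simp
    omega

/-- **Isometries of `T = U³ ⊕ E8(-2) ⊕ ⟨-2⟩` fix the generator of `A_{⟨-2⟩}`.**
Every isometry `φ` of `T` preserves the `A_{E8(-2)}` component of
`A_T ≅ A_{E8(-2)} ⊕ A_{⟨-2⟩}`; equivalently, the induced map `φ̄` on the discriminant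
group fixes the generator of the `A_{⟨-2⟩}` summand: if `F` is the `ℚ`-linear extension
of `φ` to `T ⊗ ℚ`, then `F (δ/2) ≡ δ/2` modulo `T`. -/
theorem isometry_fixes_characteristic_generator :
    ∀ φ : TK3 ≃ₗ[ℤ] TK3, (∀ s t : TK3, bTK3 (φ s) (φ t) = bTK3 s t) →
      ∀ F : VTK3 ≃ₗ[ℚ] VTK3, (∀ t : TK3, F (iotaT t) = iotaT (φ t)) →
        F wT - wT ∈ LinearMap.range iotaT := by
  intro φ hφ F hF
  obtain ⟨v, hv⟩ := exists_isometry_apply_eq_add_two_smul φ hφ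
  have hw : iotaT (0, 0, 1) = (2 : ℚ) • wT := by
    refine Prod.ext (funext fun i => ?_) (Prod.ext (funext fun i => ?_) ?_) <;>
      simp [iotaT, wT]
  have h := hF (0, 0, 1)
  rw [hv, map_add, map_smul, hw, map_smul, ← Int.cast_smul_eq_zsmul ℚ] at h
  refine ⟨v, smul_right_injective VTK3 (two_ne_zero (α := ℚ)) ?_⟩
  simp only [smul_sub, h]
  simp
end
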